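/- arXiv:1311.0313 — 2 statements merged into one kernel-verified Lean document; each statement's English description precedes it below -/
import Mathlib

section
/- Let n ≥ 1 be a natural number and λ ≠ 0 a real constant. If y : ℝ → ℝ is infinitely differentiable, y(x) > 0 for all x, and y satisfies y^(2n)(x) + λ · y(x)^((1+2n)/(1-2n)) = 0 for all x ∈ ℝ, then the function I₂(x) = x·(y^(n)(x))²/2 + (-1)^n · λ · x · ((1-2n)/2) · y(x)^(2/(1-2n)) + Σ_{j=0}^{n-1} (-1)^{n-j-1} · ( ((2n-2j-1)/2)·y^(j)(x) − x·y^(j+1)(x) ) · y^(2n-j-1)(x) is constant on ℝ. -/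
/-- A smooth function's iterated derivatives have derivative the next iterated derivative. -/
theorem hasDerivAt_iteratedDeriv_of_contDiff {y : ℝ → ℝ} (hy : ContDiff ℝ (⊤ : ℕ∞) y)
    (k : ℕ) (x : ℝ) : HasDerivAt (iteratedDeriv k y) (iteratedDeriv (k + 1) y x) x := by
  rw [iteratedDeriv_succ]
  have hk : (k : WithTop ℕ∞) < ((⊤ : ℕ∞) : WithTop ℕ∞) := by
    exact_mod_cast WithTop.coe_lt_top k
  exact (hy.differentiable_iteratedDeriv k hk x).hasDerivAt

/-- The characteristic `((2n-2j-1)/2) y^(j) - x y^(j+1)` at level `j` differentiates to the one at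
level `j + 1`. -/
theorem hasDerivAt_scaling_characteristic {y : ℝ → ℝ} (hy : ContDiff ℝ (⊤ : ℕ∞) y)
    (n j : ℕ) (x : ℝ) :
    HasDerivAt (fun x => (2 * (n : ℝ) - 2 * (j : ℝ) - 1) / 2 * iteratedDeriv j y x
        - x * iteratedDeriv (j + 1) y x)
      ((2 * (n : ℝ) - 2 * ((j + 1 : ℕ) : ℝ) - 1) / 2 * iteratedDeriv (j + 1) y x
        - x * iteratedDeriv (j + 1 + 1) y x) x := by
  refine (((hasDerivAt_iteratedDeriv_of_contDiff hy j x).const_mul _).sub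
    ((hasDerivAt_id x).mul (hasDerivAt_iteratedDeriv_of_contDiff hy (j + 1) x))).congr_deriv ?_
  simp only [id]
  push_cast
  ring

/-- The derivative of the boundary sum telescopes. -/
theorem hasDerivAt_sum_scaling_characteristic {y : ℝ → ℝ} (hy : ContDiff ℝ (⊤ : ℕ∞) y)
    (n : ℕ) (x : ℝ) :
    HasDerivAt (fun x => ∑ j ∈ Finset.range n, (-1 : ℝ) ^ (n - j - 1)
        * (((2 * (n : ℝ) - 2 * (j : ℝ) - 1) / 2) * iteratedDeriv j y x
            - x * iteratedDeriv (j + 1) y x)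
        * iteratedDeriv (2 * n - j - 1) y x)
      ((-(1 / 2) * iteratedDeriv n y x - x * iteratedDeriv (n + 1) y x) * iteratedDeriv n y x
        - (-1) ^ n * ((2 * (n : ℝ) - 1) / 2 * y x - x * iteratedDeriv 1 y x)
          * iteratedDeriv (2 * n) y x) x := by
  let F : ℕ → ℝ := fun j => (-1 : ℝ) ^ (n - j)
    * (((2 * (n : ℝ) - 2 * (j : ℝ) - 1) / 2) * iteratedDeriv j y x
        - x * iteratedDeriv (j + 1) y x) * iteratedDeriv (2 * n - j) y x
  have hsum := HasDerivAt.fun_sum (u := Finset.range n) (x := x)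
    (A' := fun j => F (j + 1) - F j)
    (A := fun j x => (-1 : ℝ) ^ (n - j - 1)
        * (((2 * (n : ℝ) - 2 * (j : ℝ) - 1) / 2) * iteratedDeriv j y x
            - x * iteratedDeriv (j + 1) y x)
        * iteratedDeriv (2 * n - j - 1) y x) (fun j hj => by
      have hjn : j < n := Finset.mem_range.mp hj
      refine (((hasDerivAt_scaling_characteristic hy n j x).const_mul _).mul
        (hasDerivAt_iteratedDeriv_of_contDiff hy (2 * n - j - 1) x)).congr_deriv ?_
      have h1 : n - (j + 1) = n - j - 1 := by omega
      have h2 : (-1 : ℝ) ^ (n - j) = -(-1) ^ (n - j - 1) := by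
        rw [← Nat.sub_add_cancel (show 1 ≤ n - j by omega), pow_succ]
        simp
      have h3 : 2 * n - (j + 1) = 2 * n - j - 1 := by omega
      have h4 : 2 * n - j - 1 + 1 = 2 * n - j := by omega
      simp only [F, h1, h2, h3, h4]
      ring)
  rw [Finset.sum_range_sub] at hsum
  refine hsum.congr_deriv ?_
  have h5 : 2 * n - n = n := by omega
  simp only [F, h5, Nat.sub_self, Nat.sub_zero, iteratedDeriv_zero, Nat.cast_zero, zero_add]
  ring


/-- The first integral `I₂` (scaling symmetry) of the critical-exponent equation
`y^(2n) + λ y^((1+2n)/(1-2n)) = 0` is constant on solutions. -/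
theorem stmt_2 (n : ℕ) (hn : 1 ≤ n) (lam : ℝ) (hlam : lam ≠ 0)
    (y : ℝ → ℝ) (hy : ContDiff ℝ (⊤ : ℕ∞) y) (hpos : ∀ x, 0 < y x)
    (heq : ∀ x, iteratedDeriv (2 * n) y x
      + lam * (y x) ^ ((1 + 2 * (n : ℝ)) / (1 - 2 * (n : ℝ))) = 0) :
    ∃ C : ℝ, ∀ x : ℝ,
      x * (iteratedDeriv n y x) ^ 2 / 2
        + (-1 : ℝ) ^ n * lam * x * ((1 - 2 * (n : ℝ)) / 2) * (y x) ^ (2 / (1 - 2 * (n : ℝ)))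
        + ∑ j ∈ Finset.range n, (-1 : ℝ) ^ (n - j - 1)
            * (((2 * (n : ℝ) - 2 * (j : ℝ) - 1) / 2) * iteratedDeriv j y x
                - x * iteratedDeriv (j + 1) y x)
            * iteratedDeriv (2 * n - j - 1) y x = C := by
  have hne : 1 - 2 * (n : ℝ) ≠ 0 := by
    have : (1 : ℝ) ≤ n := by exact_mod_cast hn
    linarith
  have key : ∀ x, HasDerivAt (fun x : ℝ =>
      x * (iteratedDeriv n y x) ^ 2 / 2
        + (-1 : ℝ) ^ n * lam * x * ((1 - 2 * (n : ℝ)) / 2) * (y x) ^ (2 / (1 - 2 * (n : ℝ)))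
        + ∑ j ∈ Finset.range n, (-1 : ℝ) ^ (n - j - 1)
            * (((2 * (n : ℝ) - 2 * (j : ℝ) - 1) / 2) * iteratedDeriv j y x
                - x * iteratedDeriv (j + 1) y x)
            * iteratedDeriv (2 * n - j - 1) y x) 0 x := by
    intro x
    have hy1 : HasDerivAt y (iteratedDeriv 1 y x) x := by
      simpa using hasDerivAt_iteratedDeriv_of_contDiff hy 0 x
    have hkin := ((hasDerivAt_id x).mul
      ((hasDerivAt_iteratedDeriv_of_contDiff hy n x).pow 2)).div_const 2
    have hpot := (((hasDerivAt_id x).const_mul ((-1 : ℝ) ^ n * lam)).mul_const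
      ((1 - 2 * (n : ℝ)) / 2)).mul
        (hy1.rpow_const (p := 2 / (1 - 2 * (n : ℝ))) (Or.inl (hpos x).ne'))
    refine ((hkin.add hpot).add (hasDerivAt_sum_scaling_characteristic hy n x)).congr_deriv ?_
    have hexp : 2 / (1 - 2 * (n : ℝ)) - 1 = (1 + 2 * (n : ℝ)) / (1 - 2 * (n : ℝ)) := by
      field_simp
      ring
    have hmul : y x ^ (2 / (1 - 2 * (n : ℝ)))
        = y x ^ ((1 + 2 * (n : ℝ)) / (1 - 2 * (n : ℝ))) * y x := by
      rw [← Real.rpow_add_one (hpos x).ne', ← hexp, sub_add_cancel]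
    have htop := eq_neg_of_add_eq_zero_left (heq x)
    rw [hexp, hmul, htop]
    simp only [id, Pi.pow_apply]
    field_simp
    ring
  refine ⟨_, fun x => is_const_of_deriv_eq_zero (fun x => (key x).differentiableAt)
    (fun x => (key x).deriv) x 0⟩
end

section
/- Let λ be a real constant. If y : ℝ → ℝ is infinitely differentiable, y(x) > 0 for all x, and y satisfies y''''(x) + λ · y(x)^(-5/3) = 0 for all x ∈ ℝ, then the function I(x) = y'(x)·y'''(x) − (y''(x))²/2 − (3λ/2)·y(x)^(-2/3) is constant on ℝ. -/
theorem ContDiff.hasDerivAt_iteratedDeriv {y : ℝ → ℝ} (hy : ContDiff ℝ (⊤ : ℕ∞) y) (n : ℕ)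
    (x : ℝ) : HasDerivAt (iteratedDeriv n y) (iteratedDeriv (n + 1) y x) x := by
  rw [iteratedDeriv_succ]
  exact (hy.differentiable_iteratedDeriv n (by exact_mod_cast ENat.natCast_lt_top n)
    x).hasDerivAt

/-- The translation first integral of `y'''' + λ y^{-5/3} = 0`:
`I = y' y''' − (y'')²/2 − (3λ/2) y^{-2/3}` is constant on solutions. -/
theorem stmt_8 (lam : ℝ) (y : ℝ → ℝ) (hy : ContDiff ℝ (⊤ : ℕ∞) y) (hpos : ∀ x, 0 < y x)
    (heq : ∀ x, iteratedDeriv 4 y x + lam * (y x) ^ (-5 / 3 : ℝ) = 0) :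
    ∃ C : ℝ, ∀ x : ℝ,
      deriv y x * iteratedDeriv 3 y x - (iteratedDeriv 2 y x) ^ 2 / 2
        - (3 * lam / 2) * (y x) ^ (-2 / 3 : ℝ) = C := by
  have hI (x : ℝ) : HasDerivAt (fun x ↦ deriv y x * iteratedDeriv 3 y x
      - (iteratedDeriv 2 y x) ^ 2 / 2 - (3 * lam / 2) * (y x) ^ (-2 / 3 : ℝ)) 0 x := by
    have h₀ : HasDerivAt y (deriv y x) x := by
      simpa using hy.hasDerivAt_iteratedDeriv 0 x
    have h₁ : HasDerivAt (deriv y) (iteratedDeriv 2 y x) x := by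
      simpa using hy.hasDerivAt_iteratedDeriv 1 x
    have h₂ := hy.hasDerivAt_iteratedDeriv 2 x
    have h₃ := hy.hasDerivAt_iteratedDeriv 3 x
    have hpow := h₀.rpow_const (p := (-2 / 3 : ℝ)) (Or.inl (hpos x).ne')
    rw [show (-2 / 3 - 1 : ℝ) = -5 / 3 by norm_num] at hpow
    refine (((h₁.mul h₃).sub ((h₂.pow 2).div_const 2)).sub
      (hpow.const_mul (3 * lam / 2))).congr_deriv ?_
    simp only [Nat.reduceAdd, Nat.cast_ofNat, Nat.add_one_sub_one, pow_one]
    linear_combination deriv y x * heq x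
  exact ⟨_, fun x ↦ is_const_of_deriv_eq_zero (fun x ↦ (hI x).differentiableAt)
    (fun x ↦ (hI x).deriv) x 0⟩
end
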